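/- There exist infinitely many pairwise non-isomorphic 4-vertex-critical P_7-free graphs; consequently there are infinitely many 4-critical P_7-free graphs. -/

import Mathlib

/-- Pokrovskiy's graph on `3 * r + 1` cyclically ordered vertices: two vertices are adjacent when
they are cyclically consecutive or their difference is congruent to `2` modulo `3`. -/
def pokrovskiyGraph (r : ℕ) : SimpleGraph (Fin (3 * r + 1)) where
  Adj i j :=
    (i.val < j.val ∧ (j.val - i.val = 1 ∨ j.val - i.val = 3 * r ∨ (j.val - i.val) % 3 = 2)) ∨
    (j.val < i.val ∧ (i.val - j.val = 1 ∨ i.val - j.val = 3 * r ∨ (i.val - j.val) % 3 = 2))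
  symm := ⟨fun _ _ h => h.symm⟩
  loopless := ⟨fun _ h => by omega⟩

namespace pokrovskiyGraph

variable {r : ℕ}

theorem adj_iff {i j : Fin (3 * r + 1)} : (pokrovskiyGraph r).Adj i j ↔
    (i.val < j.val ∧ (j.val - i.val = 1 ∨ j.val - i.val = 3 * r ∨ (j.val - i.val) % 3 = 2)) ∨
    (j.val < i.val ∧ (i.val - j.val = 1 ∨ i.val - j.val = 3 * r ∨ (i.val - j.val) % 3 = 2)) :=
  Iff.rfl

theorem val_sub_cases {n : ℕ} (x u : Fin n) :
    (u.val ≤ x.val ∧ (x - u).val = x.val - u.val) ∨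
    (x.val < u.val ∧ (x - u).val = n + x.val - u.val) := by
  rcases le_or_gt u x with h | h
  · exact Or.inl ⟨h, Fin.coe_sub_iff_le.2 h⟩
  · exact Or.inr ⟨h, Fin.coe_sub_iff_lt.2 h⟩

theorem adj_sub_iff (u x y : Fin (3 * r + 1)) :
    (pokrovskiyGraph r).Adj (x - u) (y - u) ↔ (pokrovskiyGraph r).Adj x y := by
  rw [adj_iff, adj_iff]
  have hx := x.isLt
  have hy := y.isLt
  have hu := u.isLt
  rcases val_sub_cases x u with ⟨h1, h2⟩ | ⟨h1, h2⟩ <;>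
    rcases val_sub_cases y u with ⟨h3, h4⟩ | ⟨h3, h4⟩ <;> rw [h2, h4] <;> omega

/-- The non-neighbours of `0` induce a half graph between the residues `0` and `1` modulo `3`. -/
theorem adj_iff_of_not_adj_zero {x y : Fin (3 * r + 1)} (hx : x ≠ 0) (hy : y ≠ 0)
    (hx' : ¬ (pokrovskiyGraph r).Adj 0 x) (hy' : ¬ (pokrovskiyGraph r).Adj 0 y) :
    (pokrovskiyGraph r).Adj x y ↔
      (x.val % 3 = 0 ∧ y.val % 3 = 1 ∧ y.val ≤ x.val + 1) ∨
      (y.val % 3 = 0 ∧ x.val % 3 = 1 ∧ x.val ≤ y.val + 1) := by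
  rw [adj_iff] at *
  have hx0 : x.val ≠ 0 := fun h => hx (Fin.ext h)
  have hy0 : y.val ≠ 0 := fun h => hy (Fin.ext h)
  have := x.isLt
  have := y.isLt
  simp only [Fin.val_zero] at hx' hy'
  have h1 : x.val % 3 ≠ 2 ∧ x.val ≠ 1 ∧ x.val ≠ 3 * r := by omega
  have h2 : y.val % 3 ≠ 2 ∧ y.val ≠ 1 ∧ y.val ≠ 3 * r := by omega
  clear hx' hy'
  omega

/-- The non-neighbours of `0` contain no induced pair of disjoint edges. -/
theorem no_induced_two_edges_of_not_adj_zero {a b c d : Fin (3 * r + 1)}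
    (ha : a ≠ 0) (hb : b ≠ 0) (hc : c ≠ 0) (hd : d ≠ 0)
    (ha' : ¬ (pokrovskiyGraph r).Adj 0 a) (hb' : ¬ (pokrovskiyGraph r).Adj 0 b)
    (hc' : ¬ (pokrovskiyGraph r).Adj 0 c) (hd' : ¬ (pokrovskiyGraph r).Adj 0 d)
    (hab : (pokrovskiyGraph r).Adj a b) (hcd : (pokrovskiyGraph r).Adj c d)
    (hac : ¬ (pokrovskiyGraph r).Adj a c) (had : ¬ (pokrovskiyGraph r).Adj a d)
    (hbc : ¬ (pokrovskiyGraph r).Adj b c) (hbd : ¬ (pokrovskiyGraph r).Adj b d) : False := by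
  rw [adj_iff_of_not_adj_zero (by assumption) (by assumption) (by assumption) (by assumption)]
    at hab hcd hac had hbc hbd
  rcases hab with ⟨h1, h2, h3⟩ | ⟨h1, h2, h3⟩ <;> rcases hcd with ⟨h4, h5, h6⟩ | ⟨h4, h5, h6⟩ <;>
    simp only [h1, h2, h4, h5, true_and, false_and, or_false, false_or, not_le,
      zero_ne_one, one_ne_zero] at hac had hbc hbd <;> omega

theorem isEmpty_pathGraph_seven_embedding (r : ℕ) :
    IsEmpty (SimpleGraph.pathGraph 7 ↪g pokrovskiyGraph r) := by
  refine ⟨fun f => ?_⟩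
  have hadj (i j : Fin 7) : (pokrovskiyGraph r).Adj (f i - f 0) (f j - f 0) ↔
      (i.val + 1 = j.val ∨ j.val + 1 = i.val) := by
    rw [adj_sub_iff, f.map_adj_iff, SimpleGraph.pathGraph_adj]
  have hne (i : Fin 7) (hi : i ≠ 0) : f i - f 0 ≠ 0 :=
    sub_ne_zero.2 (f.injective.ne hi)
  have h0 (i : Fin 7) (hi : 2 ≤ i.val) : ¬ (pokrovskiyGraph r).Adj 0 (f i - f 0) := by
    have h := hadj 0 i
    rw [sub_self] at h
    rw [h, Fin.val_zero]
    omega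
  exact no_induced_two_edges_of_not_adj_zero
    (hne 2 (by decide)) (hne 3 (by decide)) (hne 5 (by decide)) (hne 6 (by decide))
    (h0 2 (by decide)) (h0 3 (by decide)) (h0 5 (by decide)) (h0 6 (by decide))
    ((hadj 2 3).2 (by decide)) ((hadj 5 6).2 (by decide))
    ((hadj 2 5).not.2 (by decide)) ((hadj 2 6).not.2 (by decide))
    ((hadj 3 5).not.2 (by decide)) ((hadj 3 6).not.2 (by decide))

theorem colorable_four (r : ℕ) : (pokrovskiyGraph r).Colorable 4 := by
  refine ⟨SimpleGraph.Coloring.mk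
    (fun x => if x.val = 0 then (3 : Fin 4) else ⟨x.val % 3, by omega⟩) ?_⟩
  intro x y h
  rw [adj_iff] at h
  have := x.isLt
  have := y.isLt
  rw [Ne, Fin.ext_iff]
  split_ifs <;> simp <;> omega

theorem induce_compl_zero_colorable_three (r : ℕ) :
    ((pokrovskiyGraph r).induce ({0}ᶜ : Set (Fin (3 * r + 1)))).Colorable 3 := by
  refine ⟨SimpleGraph.Coloring.mk (fun x => (⟨x.val.val % 3, by omega⟩ : Fin 3)) ?_⟩
  rintro ⟨x, hx⟩ ⟨y, hy⟩ h
  rw [SimpleGraph.comap_adj, Function.Embedding.subtype_apply, Function.Embedding.subtype_apply,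
    adj_iff] at h
  have hx0 : x.val ≠ 0 := fun h => hx (Fin.ext h)
  have hy0 : y.val ≠ 0 := fun h => hy (Fin.ext h)
  have := x.isLt
  have := y.isLt
  rw [Ne, Fin.ext_iff]
  dsimp only at h ⊢
  omega

theorem induce_compl_singleton_colorable_three (v : Fin (3 * r + 1)) :
    ((pokrovskiyGraph r).induce ({v}ᶜ : Set (Fin (3 * r + 1)))).Colorable 3 := by
  refine (induce_compl_zero_colorable_three r).of_hom
    ⟨fun x => ⟨x.val - v, fun h => x.property (sub_eq_zero.1 h)⟩, ?_⟩
  intro x y h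
  exact (adj_sub_iff v x.val y.val).2 h

theorem not_colorable_three (hr : 0 < r) : ¬ (pokrovskiyGraph r).Colorable 3 := by
  rintro ⟨C⟩
  have hne (i j : ℕ) (hi : i < 3 * r + 1) (hj : j < 3 * r + 1) (hij : i < j)
      (h : j - i = 1 ∨ j - i = 3 * r ∨ (j - i) % 3 = 2) : C ⟨i, hi⟩ ≠ C ⟨j, hj⟩ :=
    C.valid (adj_iff.2 (Or.inl ⟨hij, h⟩))
  have hall (k : ℕ) (hk : 3 * k < 3 * r + 1) : C ⟨3 * k, hk⟩ = C 0 := by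
    induction k with
    | zero => rfl
    | succ k ih =>
      rw [← ih (by omega)]
      have h01 := hne (3 * k) (3 * k + 1) (by omega) (by omega) (by omega) (by omega)
      have h02 := hne (3 * k) (3 * k + 2) (by omega) (by omega) (by omega) (by omega)
      have h12 := hne (3 * k + 1) (3 * k + 2) (by omega) (by omega) (by omega) (by omega)
      have h13 := hne (3 * k + 1) (3 * (k + 1)) (by omega) (by omega) (by omega) (by omega)
      have h23 := hne (3 * k + 2) (3 * (k + 1)) (by omega) (by omega) (by omega) (by omega)
      omega
  exact hne 0 (3 * r) (by omega) (by omega) (by omega) (by omega) (hall r (by omega)).symm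

end pokrovskiyGraph

namespace SimpleGraph

theorem chromaticNumber_eq_four {V : Type*} {G : SimpleGraph V} (h4 : G.Colorable 4)
    (h3 : ¬ G.Colorable 3) : G.chromaticNumber = 4 :=
  le_antisymm h4.chromaticNumber_le (by
    have h : ((3 : ℕ) : ℕ∞) < G.chromaticNumber :=
      not_le.1 (mt chromaticNumber_le_iff_colorable.1 h3)
    exact Order.add_one_le_of_lt h)

/-- A finite `k`-vertex-critical `F`-free graph has a spanning subgraph which is critical
among all its `F`-free subgraphs. -/
theorem exists_critical_spanning_subgraph {V W : Type*} [Finite V] {F : SimpleGraph W}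
    {G : SimpleGraph V} {k : ℕ} (hF : IsEmpty (F ↪g G)) (hG : ¬ G.Colorable k)
    (hv : ∀ v, (G.induce ({v}ᶜ : Set V)).Colorable k) :
    ∃ H ≤ G, IsEmpty (F ↪g H) ∧ ¬ H.Colorable k ∧
      ∀ (s : Set V) (K : SimpleGraph s), K ≤ H.induce s →
        (s ≠ Set.univ ∨ K ≠ H.induce s) → IsEmpty (F ↪g K) → K.Colorable k := by
  obtain ⟨H, hHG, ⟨hHF, hHk⟩, hmin⟩ := exists_minimal_le_of_wellFoundedLT
    (fun H : SimpleGraph V => IsEmpty (F ↪g H) ∧ ¬ H.Colorable k) G ⟨hF, hG⟩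
  refine ⟨H, hHG, hHF, hHk, fun s K hK hne hKF => ?_⟩
  by_cases hs : s = Set.univ
  · subst hs
    replace hne := hne.resolve_left (not_not.2 rfl)
    let e : V ≃ (Set.univ : Set V) := (Equiv.Set.univ V).symm
    let φ : K.comap e ≃g K := Iso.comap e K
    by_contra hKk
    have hle : K.comap e ≤ H := fun x y h => hK h
    have hge : H ≤ K.comap e := hmin
      ⟨⟨fun f => hKF.false (φ.toEmbedding.comp f)⟩,
        fun h => hKk (h.of_hom φ.symm.toHom)⟩ hle
    exact hne (le_antisymm hK fun x y h => hge h)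
  · obtain ⟨v, hvs⟩ := (Set.ne_univ_iff_exists_notMem s).1 hs
    refine (hv v).of_hom ⟨fun x => ⟨x.val, fun h => hvs (h ▸ x.property)⟩, ?_⟩
    intro x y h
    exact hHG (hK h)

end SimpleGraph


/-- There are infinitely many (pairwise non-isomorphic, as witnessed by
unboundedly many vertices) 4-vertex-critical `P₇`-free graphs, and consequently
infinitely many 4-critical `P₇`-free graphs. -/
theorem infinitely_many_4critical_P7_free :
    (∀ n : ℕ, ∃ (m : ℕ) (G : SimpleGraph (Fin m)),
      n ≤ m ∧ IsEmpty (SimpleGraph.pathGraph 7 ↪g G) ∧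
      G.chromaticNumber = 4 ∧
      ∀ v : Fin m, (G.induce ({v}ᶜ : Set (Fin m))).Colorable 3) ∧
    (∀ n : ℕ, ∃ (m : ℕ) (G : SimpleGraph (Fin m)),
      n ≤ m ∧ IsEmpty (SimpleGraph.pathGraph 7 ↪g G) ∧
      G.chromaticNumber = 4 ∧
      ∀ (s : Set (Fin m)) (H : SimpleGraph s), H ≤ G.induce s →
        (s ≠ Set.univ ∨ H ≠ G.induce s) →
        IsEmpty (SimpleGraph.pathGraph 7 ↪g H) → H.Colorable 3) := by
  refine ⟨fun n => ⟨3 * (n + 1) + 1, pokrovskiyGraph (n + 1), by omega,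
    pokrovskiyGraph.isEmpty_pathGraph_seven_embedding _,
    SimpleGraph.chromaticNumber_eq_four (pokrovskiyGraph.colorable_four _)
      (pokrovskiyGraph.not_colorable_three n.succ_pos),
    pokrovskiyGraph.induce_compl_singleton_colorable_three⟩, fun n => ?_⟩
  obtain ⟨H, hHG, hHF, hH3, hcrit⟩ := SimpleGraph.exists_critical_spanning_subgraph
    (pokrovskiyGraph.isEmpty_pathGraph_seven_embedding (n + 1))
    (pokrovskiyGraph.not_colorable_three n.succ_pos)
    pokrovskiyGraph.induce_compl_singleton_colorable_three
  exact ⟨3 * (n + 1) + 1, H, by omega, hHF,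
    SimpleGraph.chromaticNumber_eq_four ((pokrovskiyGraph.colorable_four _).mono_left hHG) hH3,
    hcrit⟩
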